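/- Let d ≥ 1 and N > 0, and let M(N) be the expected minimum bipartite matching length in the Poissonized model on [0,1]^d with intensity N. Then for every integer m ≥ 2, writing m = 2^K + r with integer K ≥ 0 and 0 ≤ r < 2^K, one has M(N) ≤ m^{d−1} M(N / m^d) + 2^d √(2 d N) Σ_{k=0}^{K} 2^{k(d/2 − 1)}. -/

import Mathlib

open MeasureTheory ProbabilityTheory Filter

noncomputable section

/-- The unit cube `[0,1]^d` in Euclidean space `ℝ^d`. -/
def unitCube (d : ℕ) : Set (EuclideanSpace ℝ (Fin d)) :=
  {x | ∀ i, x i ∈ Set.Icc (0 : ℝ) 1}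

/-- The uniform probability measure on the unit cube `[0,1]^d`
(the cube has Lebesgue measure one, so the restriction of Lebesgue measure
to the cube is the uniform probability measure on it). -/
def unifCube (d : ℕ) : Measure (EuclideanSpace ℝ (Fin d)) :=
  volume.restrict (unitCube d)

/-- `LMBMon X Y A B` is the minimum total Euclidean length of a partial bipartite
matching pairing `min A.card B.card` of the points `X j, j ∈ A` with as many of the
points `Y j, j ∈ B`, each pair consisting of one `X`-point and one `Y`-point. -/
def LMBMon {d N₁ N₂ : ℕ} (X : Fin N₁ → EuclideanSpace ℝ (Fin d))
    (Y : Fin N₂ → EuclideanSpace ℝ (Fin d)) (A : Finset (Fin N₁)) (B : Finset (Fin N₂)) : ℝ :=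
  sInf { s | ∃ (σ : Fin (min A.card B.card) ↪ Fin N₁) (τ : Fin (min A.card B.card) ↪ Fin N₂),
    (∀ i, σ i ∈ A) ∧ (∀ i, τ i ∈ B) ∧ s = ∑ i, dist (X (σ i)) (Y (τ i)) }

/-- `LMBM X Y` : the minimum total Euclidean length of a bipartite matching between the
points of `X` and the points of `Y`; if the two families have different cardinalities
`N₁ ≠ N₂`, it is the minimum length of a partial matching pairing `min N₁ N₂` points of
each family, leaving `|N₁ - N₂|` points unmatched. -/
def LMBM {d N₁ N₂ : ℕ} (X : Fin N₁ → EuclideanSpace ℝ (Fin d))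
    (Y : Fin N₂ → EuclideanSpace ℝ (Fin d)) : ℝ :=
  LMBMon X Y Finset.univ Finset.univ

/-- `MP d lam`: the expected length of a minimum bipartite matching in the Poissonized
model on `[0,1]^d` with intensity `lam`: the numbers `n₁, n₂` of points of the two
families are independent Poisson(lam) variables and the points are i.i.d. uniform
on the cube. -/
def MP (d : ℕ) (lam : ℝ) : ℝ :=
  ∑' n₁ : ℕ, ∑' n₂ : ℕ,
    (Real.exp (-lam) * lam ^ n₁ / n₁.factorial) *
      ((Real.exp (-lam) * lam ^ n₂ / n₂.factorial) *
        ∫ p : (Fin n₁ → EuclideanSpace ℝ (Fin d)) × (Fin n₂ → EuclideanSpace ℝ (Fin d)),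
          LMBM p.1 p.2 ∂ ((Measure.pi fun _ => unifCube d).prod (Measure.pi fun _ => unifCube d)))

end
/-- `M` is a partial matching between `A` and `B`. -/
def IsMat {n₁ n₂ : ℕ} (A : Finset (Fin n₁)) (B : Finset (Fin n₂))
    (M : Finset (Fin n₁ × Fin n₂)) : Prop :=
  (∀ p ∈ M, p.1 ∈ A ∧ p.2 ∈ B) ∧ (∀ p ∈ M, ∀ q ∈ M, p.1 = q.1 → p = q) ∧
    (∀ p ∈ M, ∀ q ∈ M, p.2 = q.2 → p = q)

section det
variable {d n₁ n₂ : ℕ} (X : Fin n₁ → EuclideanSpace ℝ (Fin d))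
  (Y : Fin n₂ → EuclideanSpace ℝ (Fin d))

lemma exists_emb_of_mat {A : Finset (Fin n₁)} {B : Finset (Fin n₂)}
    {M : Finset (Fin n₁ × Fin n₂)} (h : IsMat A B M) {k : ℕ} (hk : M.card = k) :
    ∃ (σ : Fin k ↪ Fin n₁) (τ : Fin k ↪ Fin n₂), (∀ i, σ i ∈ A) ∧ (∀ i, τ i ∈ B) ∧
      ∑ p ∈ M, dist (X p.1) (Y p.2) = ∑ i, dist (X (σ i)) (Y (τ i)) := by
  let e := M.equivFinOfCardEq hk
  refine ⟨⟨fun i => (e.symm i).1.1, fun i j hij => ?_⟩,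
    ⟨fun i => (e.symm i).1.2, fun i j hij => ?_⟩, ?_, ?_, ?_⟩
  · exact e.symm.injective (Subtype.ext (h.2.1 _ (e.symm i).2 _ (e.symm j).2 hij))
  · exact e.symm.injective (Subtype.ext (h.2.2 _ (e.symm i).2 _ (e.symm j).2 hij))
  · intro i; exact (h.1 _ (e.symm i).2).1
  · intro i; exact (h.1 _ (e.symm i).2).2
  · rw [← Finset.sum_coe_sort M]
    exact (Equiv.sum_comp e.symm (fun p : M => dist (X p.1.1) (Y p.1.2))).symm

lemma LMBMon_bdd (A : Finset (Fin n₁)) (B : Finset (Fin n₂)) : BddBelow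
    { s | ∃ (σ : Fin (min A.card B.card) ↪ Fin n₁) (τ : Fin (min A.card B.card) ↪ Fin n₂),
    (∀ i, σ i ∈ A) ∧ (∀ i, τ i ∈ B) ∧ s = ∑ i, dist (X (σ i)) (Y (τ i)) } := by
  refine ⟨0, ?_⟩
  rintro s ⟨σ, τ, -, -, rfl⟩
  exact Finset.sum_nonneg fun _ _ => dist_nonneg

lemma LMBMon_nonneg (A : Finset (Fin n₁)) (B : Finset (Fin n₂)) : 0 ≤ LMBMon X Y A B := by
  apply Real.sInf_nonneg
  rintro s ⟨σ, τ, -, -, rfl⟩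
  exact Finset.sum_nonneg fun _ _ => dist_nonneg

lemma LMBMon_le {A : Finset (Fin n₁)} {B : Finset (Fin n₂)}
    {M : Finset (Fin n₁ × Fin n₂)} (h : IsMat A B M) (hk : M.card = min A.card B.card) :
    LMBMon X Y A B ≤ ∑ p ∈ M, dist (X p.1) (Y p.2) := by
  obtain ⟨σ, τ, h1, h2, h3⟩ := exists_emb_of_mat X Y h hk
  exact csInf_le (LMBMon_bdd X Y A B) ⟨σ, τ, h1, h2, h3⟩

lemma mat_extend {A : Finset (Fin n₁)} {B : Finset (Fin n₂)}
    {M : Finset (Fin n₁ × Fin n₂)} (h : IsMat A B M) (D : ℝ)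
    (hD : ∀ a ∈ A, ∀ b ∈ B, dist (X a) (Y b) ≤ D) (q : ℕ)
    (hq : M.card + q ≤ min A.card B.card) :
    ∃ M', IsMat A B M' ∧ M'.card = M.card + q ∧
      ∑ p ∈ M', dist (X p.1) (Y p.2) ≤ ∑ p ∈ M, dist (X p.1) (Y p.2) + q * D := by
  classical
  induction q with
  | zero => exact ⟨M, h, by simp, by simp⟩
  | succ q ih =>
    obtain ⟨M', hM', hc, hs⟩ := ih (by omega)
    have h1 : (M'.image Prod.fst).card < A.card :=
      lt_of_le_of_lt Finset.card_image_le (by omega)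
    have h2 : (M'.image Prod.snd).card < B.card :=
      lt_of_le_of_lt Finset.card_image_le (by omega)
    obtain ⟨a, haA, ha⟩ := Finset.exists_mem_notMem_of_card_lt_card h1
    obtain ⟨b, hbB, hb⟩ := Finset.exists_mem_notMem_of_card_lt_card h2
    have ha' : ∀ p ∈ M', p.1 ≠ a := fun p hp e => ha (Finset.mem_image.2 ⟨p, hp, e⟩)
    have hb' : ∀ p ∈ M', p.2 ≠ b := fun p hp e => hb (Finset.mem_image.2 ⟨p, hp, e⟩)
    have hn : (a, b) ∉ M' := fun hp => ha' _ hp rfl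
    refine ⟨insert (a, b) M', ⟨?_, ?_, ?_⟩, ?_, ?_⟩
    · intro p hp
      rcases Finset.mem_insert.1 hp with rfl | hp
      · exact ⟨haA, hbB⟩
      · exact hM'.1 p hp
    · intro p hp p' hp' e
      rcases Finset.mem_insert.1 hp with rfl | hp <;>
        rcases Finset.mem_insert.1 hp' with rfl | hp'
      · rfl
      · exact absurd e.symm (ha' _ hp')
      · exact absurd e (ha' _ hp)
      · exact hM'.2.1 _ hp _ hp' e
    · intro p hp p' hp' e
      rcases Finset.mem_insert.1 hp with rfl | hp <;>
        rcases Finset.mem_insert.1 hp' with rfl | hp'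
      · rfl
      · exact absurd e.symm (hb' _ hp')
      · exact absurd e (hb' _ hp)
      · exact hM'.2.2 _ hp _ hp' e
    · rw [Finset.card_insert_of_notMem hn, hc]; omega
    · rw [Finset.sum_insert hn]
      have := hD a haA b hbB
      push_cast
      linarith

lemma LMBMon_exists (A : Finset (Fin n₁)) (B : Finset (Fin n₂)) :
    ∃ M, IsMat A B M ∧ M.card = min A.card B.card ∧
      ∑ p ∈ M, dist (X p.1) (Y p.2) = LMBMon X Y A B := by
  classical
  set S := { s | ∃ (σ : Fin (min A.card B.card) ↪ Fin n₁) (τ : Fin (min A.card B.card) ↪ Fin n₂),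
    (∀ i, σ i ∈ A) ∧ (∀ i, τ i ∈ B) ∧ s = ∑ i, dist (X (σ i)) (Y (τ i)) } with hS
  have hfin : S.Finite := by
    refine (Set.finite_range (fun q : (Fin (min A.card B.card) ↪ Fin n₁) ×
      (Fin (min A.card B.card) ↪ Fin n₂) => ∑ i, dist (X (q.1 i)) (Y (q.2 i)))).subset ?_
    rintro s ⟨σ, τ, -, -, rfl⟩
    exact ⟨(σ, τ), rfl⟩
  have hne : S.Nonempty := by
    have h0 : IsMat A B ∅ := ⟨by simp, by simp, by simp⟩
    let D := ∑ a, ∑ b, dist (X a) (Y b)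
    obtain ⟨M, hM, hc, -⟩ := mat_extend X Y h0 D (fun a _ b _ =>
      (Finset.single_le_sum (f := fun b => dist (X a) (Y b)) (fun _ _ => dist_nonneg)
        (Finset.mem_univ b)).trans
      (Finset.single_le_sum (f := fun a => ∑ b, dist (X a) (Y b))
        (fun _ _ => Finset.sum_nonneg fun _ _ => dist_nonneg) (Finset.mem_univ a)))
      (min A.card B.card) (by simp)
    obtain ⟨σ, τ, h1, h2, h3⟩ := exists_emb_of_mat X Y hM (k := min A.card B.card) (by simpa using hc)
    exact ⟨_, σ, τ, h1, h2, rfl⟩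
  obtain ⟨σ, τ, h1, h2, h3⟩ := hne.csInf_mem hfin
  have hinj : Function.Injective (fun i => (σ i, τ i)) := fun i j e => σ.injective (Prod.ext_iff.1 e).1
  refine ⟨Finset.univ.image (fun i => (σ i, τ i)), ⟨?_, ?_, ?_⟩, ?_, ?_⟩
  · intro p hp
    obtain ⟨i, -, rfl⟩ := Finset.mem_image.1 hp
    exact ⟨h1 i, h2 i⟩
  · intro p hp q hq e
    obtain ⟨i, -, rfl⟩ := Finset.mem_image.1 hp
    obtain ⟨j, -, rfl⟩ := Finset.mem_image.1 hq
    rw [σ.injective e]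
  · intro p hp q hq e
    obtain ⟨i, -, rfl⟩ := Finset.mem_image.1 hp
    obtain ⟨j, -, rfl⟩ := Finset.mem_image.1 hq
    rw [τ.injective e]
  · rw [Finset.card_image_of_injective _ hinj]; simp
  · rw [Finset.sum_image (fun _ _ _ _ e => hinj e)]
    exact h3.symm

/-- the matching functional of the restricted families -/
lemma LMBMon_le_comp (A : Finset (Fin n₁)) (B : Finset (Fin n₂)) :
    LMBMon X Y A B ≤ LMBM (fun i => X (A.orderEmbOfFin rfl i)) (fun i => Y (B.orderEmbOfFin rfl i)) := by
  classical
  obtain ⟨M, hM, hc, hs⟩ := LMBMon_exists (fun i => X (A.orderEmbOfFin rfl i))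
    (fun i => Y (B.orderEmbOfFin rfl i)) Finset.univ Finset.univ
  unfold LMBM
  rw [← hs]
  set f : Fin A.card × Fin B.card → Fin n₁ × Fin n₂ :=
    fun p => (A.orderEmbOfFin rfl p.1, B.orderEmbOfFin rfl p.2) with hf
  have hinj : Function.Injective f := by
    rintro ⟨a, b⟩ ⟨a', b'⟩ e
    simp only [hf, Prod.mk.injEq] at e
    rw [(A.orderEmbOfFin rfl).injective e.1, (B.orderEmbOfFin rfl).injective e.2]
  have := LMBMon_le X Y (A := A) (B := B) (M := M.image f) ⟨?_, ?_, ?_⟩ ?_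
  · rwa [Finset.sum_image (fun _ _ _ _ e => hinj e)] at this
  · intro p hp
    obtain ⟨i, -, rfl⟩ := Finset.mem_image.1 hp
    exact ⟨Finset.orderEmbOfFin_mem _ _ _, Finset.orderEmbOfFin_mem _ _ _⟩
  · intro p hp q hq e
    obtain ⟨i, hi, rfl⟩ := Finset.mem_image.1 hp
    obtain ⟨j, hj, rfl⟩ := Finset.mem_image.1 hq
    rw [hM.2.1 i hi j hj ((A.orderEmbOfFin rfl).injective e)]
  · intro p hp q hq e
    obtain ⟨i, hi, rfl⟩ := Finset.mem_image.1 hp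
    obtain ⟨j, hj, rfl⟩ := Finset.mem_image.1 hq
    rw [hM.2.2 i hi j hj ((B.orderEmbOfFin rfl).injective e)]
  · rw [Finset.card_image_of_injective _ hinj, hc]; simp

lemma LMBMon_merge {β : Type*} [DecidableEq β] (A : Finset (Fin n₁)) (B : Finset (Fin n₂))
    (f : Fin n₁ → β) (g : Fin n₂ → β) (T : Finset β) (hf : ∀ a ∈ A, f a ∈ T)
    (hg : ∀ b ∈ B, g b ∈ T) (D : ℝ) (hD0 : 0 ≤ D)
    (hD : ∀ a ∈ A, ∀ b ∈ B, dist (X a) (Y b) ≤ D) :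
    LMBMon X Y A B ≤ ∑ c ∈ T, LMBMon X Y (A.filter (f · = c)) (B.filter (g · = c)) +
      D / 2 * ∑ c ∈ T, |((A.filter (f · = c)).card : ℝ) - (B.filter (g · = c)).card| := by
  choose M hM hc hs using fun c => LMBMon_exists X Y (A.filter (f · = c)) (B.filter (g · = c))
  have hfM : ∀ c, ∀ p ∈ M c, f p.1 = c := fun c p hp => (Finset.mem_filter.1 ((hM c).1 p hp).1).2
  have hgM : ∀ c, ∀ p ∈ M c, g p.2 = c := fun c p hp => (Finset.mem_filter.1 ((hM c).1 p hp).2).2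
  have hdisj : ∀ c ∈ T, ∀ c' ∈ T, c ≠ c' → Disjoint (M c) (M c') := by
    intro c _ c' _ hne
    rw [Finset.disjoint_left]
    intro p hp hp'
    exact hne ((hfM c p hp).symm.trans (hfM c' p hp'))
  have hMM : IsMat A B (T.biUnion M) := by
    refine ⟨?_, ?_, ?_⟩
    · intro p hp
      obtain ⟨c, hcT, hp⟩ := Finset.mem_biUnion.1 hp
      have := (hM c).1 p hp
      exact ⟨(Finset.mem_filter.1 this.1).1, (Finset.mem_filter.1 this.2).1⟩
    · intro p hp q hq e
      obtain ⟨c, hcT, hp⟩ := Finset.mem_biUnion.1 hp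
      obtain ⟨c', hcT', hq⟩ := Finset.mem_biUnion.1 hq
      have : c = c' := by rw [← hfM c p hp, ← hfM c' q hq, e]
      subst this
      exact (hM c).2.1 p hp q hq e
    · intro p hp q hq e
      obtain ⟨c, hcT, hp⟩ := Finset.mem_biUnion.1 hp
      obtain ⟨c', hcT', hq⟩ := Finset.mem_biUnion.1 hq
      have : c = c' := by rw [← hgM c p hp, ← hgM c' q hq, e]
      subst this
      exact (hM c).2.2 p hp q hq e
  have hcard : (T.biUnion M).card = ∑ c ∈ T, min (A.filter (f · = c)).card (B.filter (g · = c)).card := by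
    rw [Finset.card_biUnion hdisj]
    exact Finset.sum_congr rfl fun c _ => hc c
  have hA : A.card = ∑ c ∈ T, (A.filter (f · = c)).card := Finset.card_eq_sum_card_fiberwise hf
  have hB : B.card = ∑ c ∈ T, (B.filter (g · = c)).card := Finset.card_eq_sum_card_fiberwise hg
  have hle : (T.biUnion M).card ≤ min A.card B.card := by
    rw [hcard, hA, hB]
    exact le_min (Finset.sum_le_sum fun _ _ => min_le_left _ _)
      (Finset.sum_le_sum fun _ _ => min_le_right _ _)
  obtain ⟨q, hq⟩ := Nat.exists_eq_add_of_le hle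
  obtain ⟨M', hM', hc', hs'⟩ := mat_extend X Y hMM D hD q hq.ge
  refine (LMBMon_le X Y hM' (hc'.trans hq.symm)).trans (hs'.trans ?_)
  rw [Finset.sum_biUnion hdisj, Finset.sum_congr rfl fun c _ => hs c]
  have hq2 : 2 * (q : ℝ) ≤ ∑ c ∈ T, |((A.filter (f · = c)).card : ℝ) - (B.filter (g · = c)).card| := by
    have e1 : ∑ c ∈ T, |((A.filter (f · = c)).card : ℝ) - (B.filter (g · = c)).card| =
        A.card + B.card - 2 * ((T.biUnion M).card : ℝ) := by
      rw [hcard, hA, hB]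
      push_cast
      rw [Finset.mul_sum, ← Finset.sum_add_distrib, ← Finset.sum_sub_distrib]
      refine Finset.sum_congr rfl fun c _ => ?_
      rcases le_total ((A.filter (f · = c)).card : ℝ) ((B.filter (g · = c)).card : ℝ) with h | h
      · rw [min_eq_left h, abs_of_nonpos (by linarith)]; ring
      · rw [min_eq_right h, abs_of_nonneg (by linarith)]; ring
    rw [e1]
    have : 2 * (T.biUnion M).card + 2 * q ≤ A.card + B.card := by omega
    have : (2 * (T.biUnion M).card + 2 * q : ℝ) ≤ A.card + B.card := by exact_mod_cast this
    linarith
  nlinarith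
end det
/-- half-open unit cube -/
def hcube (d : ℕ) : Set (EuclideanSpace ℝ (Fin d)) := {x | ∀ i, x i ∈ Set.Ico (0 : ℝ) 1}

/-- block label at level `j` -/
noncomputable def lab {d : ℕ} (m j : ℕ) (x : EuclideanSpace ℝ (Fin d)) : Fin d → ℕ :=
  fun k => ⌊(m : ℝ) * x k⌋₊ / 2 ^ j

/-- block at level `j` -/
def blk {d : ℕ} (m j : ℕ) (b : Fin d → ℕ) : Set (EuclideanSpace ℝ (Fin d)) :=
  {x | x ∈ hcube d ∧ lab m j x = b}

/-- the set of all labels at level `j` -/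
def labs (d m j : ℕ) : Finset (Fin d → ℕ) :=
  Fintype.piFinset (fun _ => Finset.range ((m - 1) / 2 ^ j + 1))

lemma lab_mem {d m : ℕ} (hm : 1 ≤ m) (j : ℕ) {x : EuclideanSpace ℝ (Fin d)} (hx : x ∈ hcube d) :
    lab m j x ∈ labs d m j := by
  rw [labs, Fintype.mem_piFinset]
  intro k
  rw [Finset.mem_range, Nat.lt_succ_iff]
  apply Nat.div_le_div_right
  have hm' : (0 : ℝ) < m := by exact_mod_cast hm
  have : ⌊(m : ℝ) * x k⌋₊ < m := by
    rw [Nat.floor_lt (mul_nonneg hm'.le (hx k).1)]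
    have := (hx k).2
    nlinarith
  omega

lemma lab_succ {d m j : ℕ} (x : EuclideanSpace ℝ (Fin d)) :
    lab m (j + 1) x = fun k => lab m j x k / 2 := by
  funext k
  simp only [lab, pow_succ, Nat.div_div_eq_div_mul]

lemma labs_succ {d m j : ℕ} {c : Fin d → ℕ} (hc : c ∈ labs d m j) :
    (fun k => c k / 2) ∈ labs d m (j + 1) := by
  rw [labs, Fintype.mem_piFinset] at *
  intro k
  have := hc k
  rw [Finset.mem_range, Nat.lt_succ_iff] at *
  rw [pow_succ, ← Nat.div_div_eq_div_mul]
  exact Nat.div_le_div_right this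

lemma dist_le_of_coord {d : ℕ} (x y : EuclideanSpace ℝ (Fin d)) {s : ℝ} (hs : 0 ≤ s)
    (h : ∀ k, |x k - y k| ≤ s) : dist x y ≤ √d * s := by
  rw [EuclideanSpace.dist_eq]
  calc √(∑ i, dist (x i) (y i) ^ 2) ≤ √(∑ i : Fin d, s ^ 2) := by
        apply Real.sqrt_le_sqrt
        apply Finset.sum_le_sum
        intro i _
        rw [Real.dist_eq]
        exact pow_le_pow_left₀ (abs_nonneg _) (h i) 2
    _ = √d * s := by
        rw [Finset.sum_const, Finset.card_univ, Fintype.card_fin, nsmul_eq_mul,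
          Real.sqrt_mul (Nat.cast_nonneg _), Real.sqrt_sq hs]

lemma coord_bounds {d m j : ℕ} (hm : 1 ≤ m) {x : EuclideanSpace ℝ (Fin d)} {b : Fin d → ℕ}
    (hx : x ∈ blk m j b) (k : Fin d) :
    (b k * 2 ^ j : ℝ) / m ≤ x k ∧ x k < ((b k + 1) * 2 ^ j : ℝ) / m := by
  have hm' : (0 : ℝ) < m := by exact_mod_cast hm
  obtain ⟨hq, rfl⟩ := hx
  have h0 : 0 ≤ (m : ℝ) * x k := mul_nonneg hm'.le (hq k).1
  set f := ⌊(m : ℝ) * x k⌋₊ with hf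
  have h1 : (f : ℝ) ≤ m * x k := Nat.floor_le h0
  have h2 : m * x k < (f : ℝ) + 1 := Nat.lt_floor_add_one _
  have h3 : (f / 2 ^ j) * 2 ^ j ≤ f := Nat.div_mul_le_self _ _
  have h4 : f + 1 ≤ (f / 2 ^ j + 1) * 2 ^ j := by
    have := Nat.lt_div_mul_add (a := f) (b := 2 ^ j) (by positivity)
    rw [add_mul]; omega
  have h3' : ((f / 2 ^ j : ℕ) : ℝ) * 2 ^ j ≤ f := by exact_mod_cast h3
  have h4' : (f : ℝ) + 1 ≤ ((f / 2 ^ j : ℕ) + 1 : ℝ) * 2 ^ j := by exact_mod_cast h4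
  simp only [lab, ← hf]
  constructor
  · rw [div_le_iff₀ hm']; linarith
  · rw [lt_div_iff₀ hm']; linarith

open Classical in
lemma det_step {d n₁ n₂ m : ℕ} (hm : 1 ≤ m) (X : Fin n₁ → EuclideanSpace ℝ (Fin d))
    (Y : Fin n₂ → EuclideanSpace ℝ (Fin d)) (hX : ∀ i, X i ∈ hcube d) (hY : ∀ i, Y i ∈ hcube d)
    (j : ℕ) :
    ∑ b ∈ labs d m (j + 1), LMBMon X Y (Finset.univ.filter (X · ∈ blk m (j + 1) b))
        (Finset.univ.filter (Y · ∈ blk m (j + 1) b)) ≤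
    ∑ b ∈ labs d m j, LMBMon X Y (Finset.univ.filter (X · ∈ blk m j b))
        (Finset.univ.filter (Y · ∈ blk m j b)) +
      √d * 2 ^ j / m * ∑ b ∈ labs d m j, |((Finset.univ.filter (X · ∈ blk m j b)).card : ℝ) -
        (Finset.univ.filter (Y · ∈ blk m j b)).card| := by
  have hm' : (0 : ℝ) < m := by exact_mod_cast hm
  have key : ∀ b ∈ labs d m (j + 1),
      LMBMon X Y (Finset.univ.filter (X · ∈ blk m (j + 1) b))
        (Finset.univ.filter (Y · ∈ blk m (j + 1) b)) ≤
      ∑ c ∈ (labs d m j).filter (fun c => (fun k => c k / 2) = b),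
        LMBMon X Y (Finset.univ.filter (X · ∈ blk m j c)) (Finset.univ.filter (Y · ∈ blk m j c)) +
      √d * 2 ^ j / m * ∑ c ∈ (labs d m j).filter (fun c => (fun k => c k / 2) = b),
        |((Finset.univ.filter (X · ∈ blk m j c)).card : ℝ) -
        (Finset.univ.filter (Y · ∈ blk m j c)).card| := by
    intro b hb
    have hgen : ∀ {n : ℕ} (Z : Fin n → EuclideanSpace ℝ (Fin d)), (∀ i, Z i ∈ hcube d) →
        ∀ i ∈ Finset.univ.filter (Z · ∈ blk m (j + 1) b),
          lab m j (Z i) ∈ (labs d m j).filter (fun c => (fun k => c k / 2) = b) := by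
      intro n Z hZ i hi
      rw [Finset.mem_filter] at hi ⊢
      exact ⟨lab_mem hm j (hZ i), by rw [← hi.2.2, lab_succ]⟩
    have hfil : ∀ {n : ℕ} (Z : Fin n → EuclideanSpace ℝ (Fin d)), (∀ i, Z i ∈ hcube d) →
        ∀ c ∈ (labs d m j).filter (fun c => (fun k => c k / 2) = b),
        (Finset.univ.filter (Z · ∈ blk m (j + 1) b)).filter (fun i => lab m j (Z i) = c) =
          Finset.univ.filter (Z · ∈ blk m j c) := by
      intro n Z hZ c hc
      ext i
      simp only [Finset.mem_filter, Finset.mem_univ, true_and, blk, Set.mem_setOf_eq] at hc ⊢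
      constructor
      · rintro ⟨⟨h1, h2⟩, h3⟩; exact ⟨h1, h3⟩
      · rintro ⟨h1, h3⟩; exact ⟨⟨h1, by rw [lab_succ, h3]; exact hc.2⟩, h3⟩
    have := LMBMon_merge X Y (Finset.univ.filter (X · ∈ blk m (j + 1) b))
      (Finset.univ.filter (Y · ∈ blk m (j + 1) b)) (fun i => lab m j (X i)) (fun i => lab m j (Y i))
      ((labs d m j).filter (fun c => (fun k => c k / 2) = b)) (hgen X hX) (hgen Y hY)
      (√d * (2 ^ (j + 1) / m)) (by positivity) (by
        intro i hi i' hi'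
        apply dist_le_of_coord _ _ (by positivity)
        intro k
        have h1 := coord_bounds hm (Finset.mem_filter.1 hi).2 k
        have h2 := coord_bounds hm (Finset.mem_filter.1 hi').2 k
        have e : ((b k + 1) * 2 ^ (j + 1) : ℝ) / m = (b k * 2 ^ (j + 1) : ℝ) / m + 2 ^ (j + 1) / m := by
          ring
        rw [abs_le]
        constructor <;> linarith [h1.1, h1.2, h2.1, h2.2])
    refine this.trans (le_of_eq ?_)
    congr 1
    · exact Finset.sum_congr rfl fun c hc => by rw [hfil X hX c hc, hfil Y hY c hc]
    · congr 1
      · rw [pow_succ]; ring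
      · exact Finset.sum_congr rfl fun c hc => by rw [hfil X hX c hc, hfil Y hY c hc]
  refine (Finset.sum_le_sum key).trans (le_of_eq ?_)
  rw [Finset.sum_add_distrib, ← Finset.mul_sum,
    Finset.sum_fiberwise_of_maps_to (fun c hc => labs_succ hc),
    Finset.sum_fiberwise_of_maps_to (fun c hc => labs_succ hc)]

open Classical in
lemma det_main {d n₁ n₂ m K : ℕ} (hm : 1 ≤ m) (hK : m ≤ 2 ^ (K + 1))
    (X : Fin n₁ → EuclideanSpace ℝ (Fin d))
    (Y : Fin n₂ → EuclideanSpace ℝ (Fin d)) (hX : ∀ i, X i ∈ hcube d) (hY : ∀ i, Y i ∈ hcube d) :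
    LMBM X Y ≤ ∑ b ∈ labs d m 0, LMBMon X Y (Finset.univ.filter (X · ∈ blk m 0 b))
        (Finset.univ.filter (Y · ∈ blk m 0 b)) +
      ∑ j ∈ Finset.range (K + 1), √d * 2 ^ j / m * ∑ b ∈ labs d m j,
        |((Finset.univ.filter (X · ∈ blk m j b)).card : ℝ) -
        (Finset.univ.filter (Y · ∈ blk m j b)).card| := by
  have hall : ∀ J, ∑ b ∈ labs d m J, LMBMon X Y (Finset.univ.filter (X · ∈ blk m J b))
        (Finset.univ.filter (Y · ∈ blk m J b)) ≤
      ∑ b ∈ labs d m 0, LMBMon X Y (Finset.univ.filter (X · ∈ blk m 0 b))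
        (Finset.univ.filter (Y · ∈ blk m 0 b)) +
      ∑ j ∈ Finset.range J, √d * 2 ^ j / m * ∑ b ∈ labs d m j,
        |((Finset.univ.filter (X · ∈ blk m j b)).card : ℝ) -
        (Finset.univ.filter (Y · ∈ blk m j b)).card| := by
    intro J
    induction J with
    | zero => simp
    | succ J ih =>
      rw [Finset.sum_range_succ]
      have := det_step hm X Y hX hY J
      linarith
  refine le_trans (le_of_eq ?_) (hall (K + 1))
  have h0 : (m - 1) / 2 ^ (K + 1) = 0 := Nat.div_eq_of_lt (by omega)
  have hl : labs d m (K + 1) = {fun _ => 0} := by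
    rw [labs, h0]
    ext c
    simp [Fintype.mem_piFinset, funext_iff]
  have hu : ∀ {n : ℕ} (Z : Fin n → EuclideanSpace ℝ (Fin d)), (∀ i, Z i ∈ hcube d) →
      Finset.univ.filter (Z · ∈ blk m (K + 1) (fun _ => 0)) = Finset.univ := by
    intro n Z hZ
    rw [Finset.filter_eq_self]
    intro i _
    refine ⟨hZ i, ?_⟩
    have := lab_mem hm (K + 1) (hZ i)
    rwa [hl, Finset.mem_singleton] at this
  rw [hl, Finset.sum_singleton, hu X hX, hu Y hY, LMBM]
open scoped ENNReal

section poisson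
variable {E : Type*} [MeasurableSpace E]

/-- Expectation of a functional of a Poisson process with intensity measure `μ`. -/
noncomputable def PE (μ : Measure E) (H : ∀ n : ℕ, (Fin n → E) → ℝ≥0∞) : ℝ≥0∞ :=
  ∑' n : ℕ, ENNReal.ofReal (Real.exp (-μ.real Set.univ)) *
    ((n.factorial : ℝ≥0∞)⁻¹ * ∫⁻ x, H n x ∂(Measure.pi fun _ => μ))

open Classical in
/-- indices of points in `C` -/
noncomputable def idx (C : Set E) {n : ℕ} (x : Fin n → E) : Finset (Fin n) :=
  Finset.univ.filter (x · ∈ C)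

/-- restriction of a configuration to the points in `C` -/
noncomputable def rst {n : ℕ} (A : Finset (Fin n)) (x : Fin n → E) : Fin A.card → E :=
  fun i => x (A.orderEmbOfFin rfl i)

lemma measurable_rst {n : ℕ} (A : Finset (Fin n)) : Measurable (rst (E := E) A) := by
  unfold rst; fun_prop

lemma measurableSet_idx {C : Set E} (hC : MeasurableSet C) {n : ℕ} (A : Finset (Fin n)) :
    MeasurableSet {x : Fin n → E | idx C x = A} := by
  have : {x : Fin n → E | idx C x = A} = ⋂ i, {x | x i ∈ C ↔ i ∈ A} := by
    ext x
    simp [idx, Finset.ext_iff]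
  rw [this]
  refine MeasurableSet.iInter fun i => ?_
  by_cases h : i ∈ A
  · simp only [h, iff_true]; exact hC.preimage (measurable_pi_apply i)
  · simp only [h, iff_false]; exact (hC.preimage (measurable_pi_apply i)).compl

lemma PE_mono {μ : Measure E} [SigmaFinite μ] {C : Set E} (hC : ∀ᵐ x ∂μ, x ∈ C)
    {H G : ∀ n : ℕ, (Fin n → E) → ℝ≥0∞}
    (h : ∀ n (x : Fin n → E), (∀ i, x i ∈ C) → H n x ≤ G n x) : PE μ H ≤ PE μ G := by
  unfold PE
  refine ENNReal.tsum_le_tsum fun n => ?_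
  gcongr 2
  refine lintegral_mono_ae ?_
  have : ∀ᵐ x ∂(Measure.pi fun _ : Fin n => μ), ∀ i, x i ∈ C := by
    rw [ae_all_iff]
    intro i
    exact (Measure.quasiMeasurePreserving_eval (fun _ : Fin n => μ) i).ae hC
  filter_upwards [this] with x hx using h n x hx

lemma PE_add {μ : Measure E} [SigmaFinite μ]
    {H G : ∀ n : ℕ, (Fin n → E) → ℝ≥0∞} (hH : ∀ n, Measurable (H n)) :
    PE μ (fun n x => H n x + G n x) = PE μ H + PE μ G := by
  unfold PE
  rw [← ENNReal.tsum_add]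
  refine tsum_congr fun n => ?_
  rw [lintegral_add_left (hH n)]
  ring

lemma PE_const_mul {μ : Measure E} [SigmaFinite μ]
    {H : ∀ n : ℕ, (Fin n → E) → ℝ≥0∞} (hH : ∀ n, Measurable (H n)) (c : ℝ≥0∞) :
    PE μ (fun n x => c * H n x) = c * PE μ H := by
  unfold PE
  rw [← ENNReal.tsum_mul_left]
  refine tsum_congr fun n => ?_
  rw [lintegral_const_mul _ (hH n)]
  ring

lemma PE_zero {μ : Measure E} : PE μ (fun _ _ => 0) = 0 := by simp [PE]

lemma measurable_PE {α : Type*} [MeasurableSpace α] {μ : Measure E} [SigmaFinite μ]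
    {H : ∀ n : ℕ, α → (Fin n → E) → ℝ≥0∞}
    (hH : ∀ n, Measurable (fun p : α × (Fin n → E) => H n p.1 p.2)) :
    Measurable (fun a => PE μ (fun n x => H n a x)) := by
  unfold PE
  refine Measurable.tsum fun n => ?_
  exact ((hH n).lintegral_prod_right').const_mul _ |>.const_mul _

lemma PE_map {F : Type*} [MeasurableSpace F] {μ : Measure E} [IsFiniteMeasure μ] {f : E → F}
    (hf : Measurable f) {H : ∀ n : ℕ, (Fin n → F) → ℝ≥0∞} (hH : ∀ n, Measurable (H n)) :
    PE (μ.map f) H = PE μ (fun n x => H n (fun i => f (x i))) := by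
  unfold PE
  have h1 : (μ.map f).real Set.univ = μ.real Set.univ := by
    simp [Measure.real, Measure.map_apply hf MeasurableSet.univ]
  rw [h1]
  refine tsum_congr fun n => ?_
  congr 2
  rw [← Measure.pi_map_pi (μ := fun _ : Fin n => μ) (f := fun _ => f) (fun _ => hf.aemeasurable),
    lintegral_map (hH n) (by fun_prop)]

lemma pi_add_measure (μ ν : Measure E) [IsFiniteMeasure μ] [IsFiniteMeasure ν] (n : ℕ) :
    Measure.pi (fun _ : Fin n => μ + ν) =
      ∑ A : Finset (Fin n), Measure.pi (fun i => if i ∈ A then μ else ν) := by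
  have inst : ∀ A : Finset (Fin n), ∀ i, SigmaFinite (if i ∈ A then μ else ν) := by
    intro A i; split_ifs <;> infer_instance
  refine Measure.pi_eq fun s hs => ?_
  rw [Measure.coe_finsetSum, Finset.sum_apply]
  simp only [Measure.coe_add, Pi.add_apply]
  rw [Fintype.prod_add]
  refine Finset.sum_congr rfl fun A _ => ?_
  have := inst A
  rw [Measure.pi_pi, ← Finset.prod_mul_prod_compl A]
  congr 1
  · exact Finset.prod_congr rfl fun i hi => by rw [if_pos hi]
  · exact Finset.prod_congr rfl fun i hi => by rw [if_neg (Finset.mem_compl.1 hi)]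

lemma map_rst (μ ν : Measure E) [IsFiniteMeasure μ] [IsFiniteMeasure ν] {n : ℕ}
    (A : Finset (Fin n)) :
    (Measure.pi (fun i => if i ∈ A then μ else ν)).map (rst A) =
      (ν Set.univ ^ (n - A.card)) • Measure.pi (fun _ : Fin A.card => μ) := by
  have inst : ∀ i, IsFiniteMeasure (if i ∈ A then μ else ν) := by
    intro i; split_ifs <;> infer_instance
  have hc : ν Set.univ ^ (n - A.card) ≠ ⊤ := ENNReal.pow_ne_top (measure_ne_top _ _)
  have inst2 : IsFiniteMeasure ((ν Set.univ ^ (n - A.card)) • Measure.pi (fun _ : Fin A.card => μ)) :=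
    Measure.smul_finite _ hc
  have key : ∀ s : Fin A.card → Set E, (∀ i, MeasurableSet (s i)) →
      (Measure.pi (fun i => if i ∈ A then μ else ν)).map (rst A) (Set.univ.pi s) =
      ((ν Set.univ ^ (n - A.card)) • Measure.pi (fun _ : Fin A.card => μ)) (Set.univ.pi s) := by
    intro s hs
    let e := A.orderEmbOfFin rfl
    rw [Measure.map_apply (measurable_rst A) (MeasurableSet.univ_pi hs)]
    have hpre : rst A ⁻¹' (Set.univ.pi s) =
        Set.univ.pi (Function.extend e s (fun _ => Set.univ)) := by
      ext x
      simp only [Set.mem_preimage, Set.mem_univ_pi, rst]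
      constructor
      · intro h i
        by_cases hi : ∃ k, e k = i
        · obtain ⟨k, rfl⟩ := hi
          rw [e.injective.extend_apply]; exact h k
        · rw [Function.extend_apply' _ _ _ hi]; trivial
      · intro h k
        have := h (e k)
        rwa [e.injective.extend_apply] at this
    rw [hpre, Measure.pi_pi, ← Finset.prod_mul_prod_compl A]
    have h2 : ∏ i ∈ Aᶜ, (if i ∈ A then μ else ν) (Function.extend e s (fun _ => Set.univ) i) =
        ν Set.univ ^ (n - A.card) := by
      rw [Finset.prod_congr rfl (g := fun _ => ν Set.univ), Finset.prod_const, Finset.card_compl,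
        Fintype.card_fin]
      intro i hi
      have hi := Finset.mem_compl.1 hi
      rw [if_neg hi, Function.extend_apply']
      rintro ⟨k, rfl⟩
      exact hi (Finset.orderEmbOfFin_mem _ _ _)
    have h1 : ∏ i ∈ A, (if i ∈ A then μ else ν) (Function.extend e s (fun _ => Set.univ) i) =
        ∏ k, μ (s k) := by
      have hA : A = Finset.univ.map e.toEmbedding := by
        ext i
        simp only [Finset.mem_map, Finset.mem_univ, true_and]
        have := Finset.range_orderEmbOfFin A rfl
        have := Set.ext_iff.1 this i
        exact this.symm
      rw [Finset.prod_congr rfl (g := fun i => μ (Function.extend e s (fun _ => Set.univ) i))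
        (fun i hi => by rw [if_pos hi])]
      have hA' : ∀ F : Fin n → ℝ≥0∞, ∏ i ∈ A, F i = ∏ k, F (e k) := by
        intro F
        calc ∏ i ∈ A, F i = ∏ i ∈ Finset.univ.map e.toEmbedding, F i := by rw [← hA]
          _ = _ := Finset.prod_map _ _ _
      rw [hA']
      refine Finset.prod_congr rfl fun k _ => ?_
      congr 1
      exact e.injective.extend_apply _ _ _
    rw [h1, h2, Measure.smul_apply, Measure.pi_pi, smul_eq_mul, mul_comm]
  refine ext_of_generate_finite _ generateFrom_pi.symm isPiSystem_pi ?_ ?_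
  · rintro _ ⟨s, hs, rfl⟩
    exact key s (fun i => hs i (Set.mem_univ i))
  · have := key (fun _ => Set.univ) (fun _ => MeasurableSet.univ)
    rwa [Set.pi_univ] at this

lemma lintegral_rst (μ : Measure E) [IsFiniteMeasure μ] {C : Set E} (hC : MeasurableSet C)
    {H : ∀ n : ℕ, (Fin n → E) → ℝ≥0∞} (hH : ∀ n, Measurable (H n)) (n : ℕ) :
    ∫⁻ x, H (idx C x).card (rst (idx C x) x) ∂(Measure.pi fun _ : Fin n => μ) =
      ∑ k ∈ Finset.range (n + 1), (n.choose k : ℝ≥0∞) * (μ Cᶜ ^ (n - k) *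
        ∫⁻ y, H k y ∂(Measure.pi fun _ : Fin k => μ.restrict C)) := by
  conv_lhs => rw [← Measure.restrict_add_restrict_compl (μ := μ) hC]
  rw [pi_add_measure, lintegral_finsetSum_measure]
  have : ∀ A : Finset (Fin n), ∫⁻ x, H (idx C x).card (rst (idx C x) x)
      ∂(Measure.pi fun i => if i ∈ A then μ.restrict C else μ.restrict Cᶜ) =
      μ Cᶜ ^ (n - A.card) * ∫⁻ y, H A.card y ∂(Measure.pi fun _ => μ.restrict C) := by
    intro A
    have inst : ∀ i, IsFiniteMeasure (if i ∈ A then μ.restrict C else μ.restrict Cᶜ) := by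
      intro i; split_ifs <;> infer_instance
    have hae : ∀ᵐ x ∂(Measure.pi fun i => if i ∈ A then μ.restrict C else μ.restrict Cᶜ),
        ∀ i, (x i ∈ C ↔ i ∈ A) := by
      rw [ae_all_iff]
      intro i
      have hq := Measure.quasiMeasurePreserving_eval
        (fun i => if i ∈ A then μ.restrict C else μ.restrict Cᶜ) i
      refine hq.ae (p := fun z => z ∈ C ↔ i ∈ A) ?_
      by_cases h : i ∈ A
      · simp only [h, iff_true, if_true]; exact ae_restrict_mem hC
      · simp only [h, iff_false, if_false]; exact ae_restrict_mem hC.compl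
    have h1 : ∀ᵐ x ∂(Measure.pi fun i => if i ∈ A then μ.restrict C else μ.restrict Cᶜ),
        H (idx C x).card (rst (idx C x) x) = H A.card (rst A x) := by
      filter_upwards [hae] with x hx
      have : idx C x = A := by
        ext i; simp [idx, hx]
      rw [this]
    rw [lintegral_congr_ae h1, ← lintegral_map (hH _) (measurable_rst A), map_rst,
      lintegral_smul_measure, Measure.restrict_apply_univ, smul_eq_mul]
  rw [Finset.sum_congr rfl fun A _ => this A]
  rw [← Finset.powerset_univ, Finset.sum_powerset_apply_card (fun k => μ Cᶜ ^ (n - k) *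
        ∫⁻ y, H k y ∂(Measure.pi fun _ : Fin k => μ.restrict C)), Finset.card_univ, Fintype.card_fin]
  simp only [nsmul_eq_mul]

lemma tsum_exp_ennreal (a : ℝ≥0∞) (ha : a ≠ ⊤) :
    ∑' n : ℕ, (n.factorial : ℝ≥0∞)⁻¹ * a ^ n = ENNReal.ofReal (Real.exp a.toReal) := by
  have h := NormedSpace.expSeries_div_hasSum_exp (𝔸 := ℝ) a.toReal
  rw [← Real.exp_eq_exp_ℝ] at h
  rw [← h.tsum_eq, ENNReal.ofReal_tsum_of_nonneg (fun n => by positivity) h.summable]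
  refine tsum_congr fun n => ?_
  rw [ENNReal.ofReal_div_of_pos (by positivity), ENNReal.ofReal_pow ENNReal.toReal_nonneg,
    ENNReal.ofReal_toReal ha, ENNReal.ofReal_natCast, div_eq_mul_inv, mul_comm]

lemma tsum_cauchy (f g : ℕ → ℝ≥0∞) :
    ∑' n : ℕ, ∑ k ∈ Finset.range (n + 1), f k * g (n - k) = (∑' n, f n) * ∑' n, g n := by
  have : ∀ n, ∑ k ∈ Finset.range (n + 1), f k * g (n - k) =
      ∑ p ∈ Finset.HasAntidiagonal.antidiagonal n, f p.1 * g p.2 := fun n =>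
    (Finset.Nat.sum_antidiagonal_eq_sum_range_succ (fun i j => f i * g j) n).symm
  simp_rw [this, ← ENNReal.tsum_mul_right, ← ENNReal.tsum_mul_left]
  rw [← ENNReal.tsum_prod (f := fun i j => f i * g j),
    ← Finset.HasAntidiagonal.sigmaAntidiagonalEquivProd.tsum_eq, ENNReal.tsum_sigma']
  refine tsum_congr fun n => ?_
  rw [tsum_fintype, ← Finset.sum_coe_sort]
  rfl

/-- thinning -/
lemma PE_thin (μ : Measure E) [IsFiniteMeasure μ] {C : Set E} (hC : MeasurableSet C)
    {H : ∀ n : ℕ, (Fin n → E) → ℝ≥0∞} (hH : ∀ n, Measurable (H n)) :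
    PE μ (fun _ x => H (idx C x).card (rst (idx C x) x)) = PE (μ.restrict C) H := by
  unfold PE
  simp_rw [lintegral_rst μ hC hH]
  set I : ℕ → ℝ≥0∞ := fun k => ∫⁻ y, H k y ∂(Measure.pi fun _ : Fin k => μ.restrict C) with hI
  rw [ENNReal.tsum_mul_left, ENNReal.tsum_mul_left]
  have h1 : ∀ n : ℕ, (n.factorial : ℝ≥0∞)⁻¹ * ∑ k ∈ Finset.range (n + 1),
      (n.choose k : ℝ≥0∞) * (μ Cᶜ ^ (n - k) * I k) =
      ∑ k ∈ Finset.range (n + 1), ((k.factorial : ℝ≥0∞)⁻¹ * I k) *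
        (((n - k).factorial : ℝ≥0∞)⁻¹ * μ Cᶜ ^ (n - k)) := by
    intro n
    rw [Finset.mul_sum]
    refine Finset.sum_congr rfl fun k hk => ?_
    have hk : k ≤ n := Nat.lt_succ_iff.1 (Finset.mem_range.1 hk)
    have e : (n.factorial : ℝ≥0∞)⁻¹ * (n.choose k : ℝ≥0∞) =
        (k.factorial : ℝ≥0∞)⁻¹ * ((n - k).factorial : ℝ≥0∞)⁻¹ := by
      have hn : ∀ j : ℕ, (j.factorial : ℝ≥0∞) ≠ 0 := fun j => by
        exact_mod_cast j.factorial_ne_zero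
      have ht : ∀ j : ℕ, (j.factorial : ℝ≥0∞) ≠ ⊤ := fun j => ENNReal.natCast_ne_top _
      rw [← ENNReal.mul_inv (Or.inl (hn _)) (Or.inl (ht _)), ← Nat.choose_mul_factorial_mul_factorial hk]
      push_cast
      have hch : (n.choose k : ℝ≥0∞) ≠ 0 := by exact_mod_cast (Nat.choose_pos hk).ne'
      have hcht : (n.choose k : ℝ≥0∞) ≠ ⊤ := ENNReal.natCast_ne_top _
      rw [mul_assoc, ENNReal.mul_inv (Or.inl hch) (Or.inl hcht), mul_right_comm,
        ENNReal.inv_mul_cancel hch hcht, one_mul]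
    calc _ = ((n.factorial : ℝ≥0∞)⁻¹ * (n.choose k : ℝ≥0∞)) * (μ Cᶜ ^ (n - k) * I k) := by ring
      _ = _ := by rw [e]; ring
  rw [tsum_congr h1, tsum_cauchy (fun k => (k.factorial : ℝ≥0∞)⁻¹ * I k)
    (fun k => (k.factorial : ℝ≥0∞)⁻¹ * μ Cᶜ ^ k), tsum_exp_ennreal _ (measure_ne_top _ _),
    mul_comm, mul_assoc, mul_comm]
  congr 1
  rw [← ENNReal.ofReal_mul (Real.exp_pos _).le, ← Real.exp_add]
  congr 2
  have := measureReal_add_measureReal_compl (μ := μ) hC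
  rw [measureReal_restrict_apply_univ, ← this]
  simp [Measure.real]

end poisson
open scoped ENNReal

section poisson2
variable {E : Type*} [MeasurableSpace E]

/-- Expectation of a functional of two independent Poisson processes. -/
noncomputable def PP (μ : Measure E) (F : ∀ n k : ℕ, (Fin n → E) → (Fin k → E) → ℝ≥0∞) : ℝ≥0∞ :=
  PE μ (fun n x => PE μ (fun k y => F n k x y))

/-- joint measurability -/
def MF (F : ∀ n k : ℕ, (Fin n → E) → (Fin k → E) → ℝ≥0∞) : Prop :=
  ∀ n k, Measurable (fun p : (Fin n → E) × (Fin k → E) => F n k p.1 p.2)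

/-- functional applied to the restriction to `C` -/
noncomputable def RF (C : Set E) (F : ∀ n k : ℕ, (Fin n → E) → (Fin k → E) → ℝ≥0∞) :
    ∀ n k : ℕ, (Fin n → E) → (Fin k → E) → ℝ≥0∞ :=
  fun _ _ x y => F (idx C x).card (idx C y).card (rst (idx C x) x) (rst (idx C y) y)

lemma MF.right {F : ∀ n k : ℕ, (Fin n → E) → (Fin k → E) → ℝ≥0∞} (h : MF F) (n k : ℕ)
    (x : Fin n → E) : Measurable (fun y => F n k x y) :=
  (h n k).comp measurable_prodMk_left

lemma MF.left {μ : Measure E} [SigmaFinite μ]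
    {F : ∀ n k : ℕ, (Fin n → E) → (Fin k → E) → ℝ≥0∞} (h : MF F) (n : ℕ) :
    Measurable (fun x => PE μ (fun k y => F n k x y)) :=
  measurable_PE (fun k => h n k)

lemma MF.rf {F : ∀ n k : ℕ, (Fin n → E) → (Fin k → E) → ℝ≥0∞} (h : MF F) {C : Set E}
    (hC : MeasurableSet C) : MF (RF C F) := by
  intro n k S hS
  have : (fun p : (Fin n → E) × (Fin k → E) => RF C F n k p.1 p.2) ⁻¹' S =
      ⋃ A : Finset (Fin n), ⋃ B : Finset (Fin k),
        ((Prod.fst ⁻¹' {x | idx C x = A}) ∩ (Prod.snd ⁻¹' {x | idx C x = B})) ∩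
        (fun p : (Fin n → E) × (Fin k → E) => F A.card B.card (rst A p.1) (rst B p.2)) ⁻¹' S := by
    ext p
    simp only [Set.mem_preimage, Set.mem_iUnion, Set.mem_inter_iff, RF]
    constructor
    · intro hp
      exact ⟨_, _, ⟨rfl, rfl⟩, hp⟩
    · rintro ⟨A, B, ⟨h1, h2⟩, hp⟩
      have h1 : idx C p.1 = A := h1
      have h2 : idx C p.2 = B := h2
      rw [h1, h2]; exact hp
  rw [this]
  refine MeasurableSet.iUnion fun A => MeasurableSet.iUnion fun B => ?_
  refine MeasurableSet.inter (MeasurableSet.inter ?_ ?_) ?_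
  · exact measurable_fst (measurableSet_idx hC A)
  · exact measurable_snd (measurableSet_idx hC B)
  · exact ((h A.card B.card).comp (((measurable_rst A).comp measurable_fst).prodMk
      ((measurable_rst B).comp measurable_snd))) hS

lemma PP_thin (μ : Measure E) [IsFiniteMeasure μ] {C : Set E} (hC : MeasurableSet C)
    {F : ∀ n k : ℕ, (Fin n → E) → (Fin k → E) → ℝ≥0∞} (hF : MF F) :
    PP μ (RF C F) = PP (μ.restrict C) F := by
  unfold PP RF
  have : ∀ (n : ℕ) (x : Fin n → E),
      PE μ (fun k y => F (idx C x).card (idx C y).card (rst (idx C x) x) (rst (idx C y) y)) =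
      PE (μ.restrict C) (fun k y => F (idx C x).card k (rst (idx C x) x) y) := fun n x =>
    PE_thin μ hC (H := fun k y => F (idx C x).card k (rst (idx C x) x) y)
      (fun k => hF.right _ _ _)
  simp_rw [this]
  exact PE_thin μ hC (H := fun n x => PE (μ.restrict C) (fun k y => F n k x y))
    (fun n => hF.left n)

lemma PP_mono {μ : Measure E} [SigmaFinite μ] {C : Set E} (hC : ∀ᵐ x ∂μ, x ∈ C)
    {F G : ∀ n k : ℕ, (Fin n → E) → (Fin k → E) → ℝ≥0∞}
    (h : ∀ n k (x : Fin n → E) (y : Fin k → E), (∀ i, x i ∈ C) → (∀ i, y i ∈ C) →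
      F n k x y ≤ G n k x y) : PP μ F ≤ PP μ G :=
  PE_mono hC fun n x hx => PE_mono hC fun k y hy => h n k x y hx hy

lemma PP_add {μ : Measure E} [SigmaFinite μ]
    {F G : ∀ n k : ℕ, (Fin n → E) → (Fin k → E) → ℝ≥0∞} (hF : MF F) :
    PP μ (fun n k x y => F n k x y + G n k x y) = PP μ F + PP μ G := by
  unfold PP
  rw [← PE_add (fun n => hF.left n)]
  congr 1
  funext n x
  exact PE_add (fun k => hF.right n k x)

lemma PP_const_mul {μ : Measure E} [SigmaFinite μ]
    {F : ∀ n k : ℕ, (Fin n → E) → (Fin k → E) → ℝ≥0∞} (hF : MF F) (c : ℝ≥0∞) :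
    PP μ (fun n k x y => c * F n k x y) = c * PP μ F := by
  unfold PP
  rw [← PE_const_mul (fun n => hF.left n)]
  congr 1
  funext n x
  exact PE_const_mul (fun k => hF.right n k x) c

lemma MF.const_mul {F : ∀ n k : ℕ, (Fin n → E) → (Fin k → E) → ℝ≥0∞} (hF : MF F) (c : ℝ≥0∞) :
    MF (fun n k x y => c * F n k x y) := fun n k => (hF n k).const_mul c

lemma MF.sum {ι : Type*} (s : Finset ι)
    {F : ι → ∀ n k : ℕ, (Fin n → E) → (Fin k → E) → ℝ≥0∞} (hF : ∀ i, MF (F i)) :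
    MF (fun n k x y => ∑ i ∈ s, F i n k x y) :=
  fun n k => Finset.measurable_sum s fun i _ => hF i n k

lemma PP_sum {μ : Measure E} [SigmaFinite μ] {ι : Type*} (s : Finset ι)
    {F : ι → ∀ n k : ℕ, (Fin n → E) → (Fin k → E) → ℝ≥0∞} (hF : ∀ i, MF (F i)) :
    PP μ (fun n k x y => ∑ i ∈ s, F i n k x y) = ∑ i ∈ s, PP μ (F i) := by
  classical
  induction s using Finset.induction_on with
  | empty => simp [PP, PE_zero]
  | insert a s ha ih =>
    simp only [Finset.sum_insert ha]
    rw [PP_add (hF a), ih]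

lemma PP_map {G : Type*} [MeasurableSpace G] {μ : Measure E} [IsFiniteMeasure μ] {f : E → G}
    (hf : Measurable f) {F : ∀ n k : ℕ, (Fin n → G) → (Fin k → G) → ℝ≥0∞} (hF : MF F) :
    PP (μ.map f) F = PP μ (fun n k x y => F n k (fun i => f (x i)) (fun i => f (y i))) := by
  unfold PP
  rw [PE_map hf (fun n => hF.left n)]
  congr 1
  funext n x
  exact PE_map hf (fun k => hF.right n k _)

lemma PE_count (μ : Measure E) [IsFiniteMeasure μ] (c : ℕ → ℝ≥0∞) :
    PE μ (fun n _ => c n) = ∑' n : ℕ, ENNReal.ofReal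
      (Real.exp (-μ.real Set.univ) * μ.real Set.univ ^ n / n.factorial) * c n := by
  unfold PE
  refine tsum_congr fun n => ?_
  rw [lintegral_const, Measure.pi_univ, Finset.prod_const, Finset.card_univ, Fintype.card_fin,
    ENNReal.ofReal_div_of_pos (by positivity), ENNReal.ofReal_mul (Real.exp_pos _).le,
    ENNReal.ofReal_pow measureReal_nonneg, ENNReal.ofReal_natCast, div_eq_mul_inv,
    ofReal_measureReal]
  ring

lemma hasSum_poisson (l a b c : ℝ) :
    HasSum (fun n : ℕ => Real.exp (-l) * l ^ n / n.factorial * (a * n ^ 2 + b * n + c))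
      (a * (l ^ 2 + l) + b * l + c) := by
  have h0 : HasSum (fun n : ℕ => l ^ n / n.factorial) (Real.exp l) := by
    have h := NormedSpace.expSeries_div_hasSum_exp (𝔸 := ℝ) l
    rwa [← Real.exp_eq_exp_ℝ] at h
  have h1 : HasSum (fun n : ℕ => (n : ℝ) * (l ^ n / n.factorial)) (l * Real.exp l) := by
    rw [← hasSum_nat_add_iff' 1]
    simp only [Finset.range_one, Finset.sum_singleton, Nat.cast_zero, zero_mul, sub_zero]
    refine (h0.mul_left l).congr_fun ?_
    intro n
    have : (n.factorial : ℝ) ≠ 0 := by positivity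
    rw [Nat.factorial_succ]; push_cast; field_simp; ring
  have h2 : HasSum (fun n : ℕ => (n : ℝ) ^ 2 * (l ^ n / n.factorial))
      (l * (l * Real.exp l) + l * Real.exp l) := by
    rw [← hasSum_nat_add_iff' 1]
    simp only [Finset.range_one, Finset.sum_singleton, Nat.cast_zero]
    rw [zero_pow two_ne_zero, zero_mul, sub_zero]
    refine ((h1.mul_left l).add (h0.mul_left l)).congr_fun ?_
    intro n
    have : (n.factorial : ℝ) ≠ 0 := by positivity
    rw [Nat.factorial_succ]; push_cast; field_simp; ring
  have h3 := (((h2.mul_left a).add (h1.mul_left b)).add (h0.mul_left c)).mul_left (Real.exp (-l))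
  have e : Real.exp (-l) * Real.exp l = 1 := by rw [← Real.exp_add]; simp
  have e2 : Real.exp (-l) * (a * (l * (l * Real.exp l) + l * Real.exp l) + b * (l * Real.exp l) +
      c * Real.exp l) = a * (l ^ 2 + l) + b * l + c := by
    linear_combination (a * (l ^ 2 + l) + b * l + c) * e
  rw [e2] at h3
  refine h3.congr_fun fun n => ?_
  ring

lemma PE_quad (μ : Measure E) [IsFiniteMeasure μ] (a b c : ℝ)
    (h : ∀ n : ℕ, 0 ≤ a * (n : ℝ) ^ 2 + b * n + c) :
    PE μ (fun n _ => ENNReal.ofReal (a * (n : ℝ) ^ 2 + b * n + c)) =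
      ENNReal.ofReal (a * ((μ.real Set.univ) ^ 2 + μ.real Set.univ) + b * μ.real Set.univ + c) := by
  have hs := hasSum_poisson (μ.real Set.univ) a b c
  have hl : 0 ≤ μ.real Set.univ := measureReal_nonneg
  rw [PE_count, ← hs.tsum_eq, ENNReal.ofReal_tsum_of_nonneg
    (fun n => mul_nonneg (by positivity) (h n)) hs.summable]
  refine tsum_congr fun n => ?_
  rw [ENNReal.ofReal_mul (by positivity)]

/-- absolute difference of counts -/
noncomputable def AD : ∀ n k : ℕ, (Fin n → E) → (Fin k → E) → ℝ≥0∞ :=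
  fun n k _ _ => ENNReal.ofReal |(n : ℝ) - k|

lemma MF_AD : MF (AD (E := E)) := fun _ _ => measurable_const

lemma PP_AD (μ : Measure E) [IsFiniteMeasure μ] (L : ℝ) (hL : 0 < L)
    (h : μ.real Set.univ ≤ L) : PP μ AD ≤ ENNReal.ofReal √(2 * L) := by
  set t := √(2 * L) with ht
  have ht0 : 0 < t := Real.sqrt_pos.2 (by positivity)
  have ht2 : t ^ 2 = 2 * L := Real.sq_sqrt (by positivity)
  set l := μ.real Set.univ with hl
  have hl0 : 0 ≤ l := measureReal_nonneg
  have key : ∀ n k : ℕ, |(n : ℝ) - k| ≤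
      1 / (2 * t) * (k : ℝ) ^ 2 + (-(n : ℝ) / t) * k + ((n : ℝ) ^ 2 / (2 * t) + t / 2) := by
    intro n k
    have e : 1 / (2 * t) * (k : ℝ) ^ 2 + (-(n : ℝ) / t) * k + ((n : ℝ) ^ 2 / (2 * t) + t / 2) =
        (|(n : ℝ) - k| ^ 2 + t ^ 2) / (2 * t) := by
      rw [sq_abs]; field_simp; ring
    rw [e, le_div_iff₀ (by positivity)]
    nlinarith [sq_nonneg (|(n : ℝ) - k| - t)]
  calc PP μ AD ≤ PP μ (fun n k _ _ => ENNReal.ofReal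
        (1 / (2 * t) * (k : ℝ) ^ 2 + (-(n : ℝ) / t) * k + ((n : ℝ) ^ 2 / (2 * t) + t / 2))) :=
        PP_mono (C := Set.univ) (by simp) fun n k x y _ _ => ENNReal.ofReal_le_ofReal (key n k)
    _ = PE μ (fun n _ => ENNReal.ofReal
        (1 / (2 * t) * (n : ℝ) ^ 2 + (-l / t) * n + ((l ^ 2 + l) / (2 * t) + t / 2))) := by
        unfold PP
        congr 1
        funext n x
        rw [PE_quad μ _ _ _ (fun k => (abs_nonneg _).trans (key n k))]
        congr 1
        rw [← hl]
        ring
    _ = ENNReal.ofReal (l / t + t / 2) := by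
        rw [PE_quad]
        · congr 1
          rw [← hl]
          field_simp; ring
        · intro n
          have : 1 / (2 * t) * (n : ℝ) ^ 2 + (-l / t) * n + ((l ^ 2 + l) / (2 * t) + t / 2) =
            ((n - l) ^ 2 + l + t ^ 2) / (2 * t) := by field_simp; ring
          rw [this]; positivity
    _ ≤ ENNReal.ofReal t := by
        apply ENNReal.ofReal_le_ofReal
        have : l / t ≤ t / 2 := by
          rw [div_le_iff₀ ht0]; nlinarith
        linarith

lemma PE_smul_prob (ν : Measure E) [IsProbabilityMeasure ν] (l : ℝ) (hl : 0 ≤ l)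
    (H : ∀ n : ℕ, (Fin n → E) → ℝ≥0∞) :
    PE (ENNReal.ofReal l • ν) H = ∑' n : ℕ, ENNReal.ofReal (Real.exp (-l) * l ^ n / n.factorial) *
      ∫⁻ x, H n x ∂(Measure.pi fun _ => ν) := by
  unfold PE
  have h1 : (ENNReal.ofReal l • ν).real Set.univ = l := by
    simp [Measure.real, hl]
  have : IsFiniteMeasure (ENNReal.ofReal l • ν) := Measure.smul_finite _ ENNReal.ofReal_ne_top
  rw [h1]
  refine tsum_congr fun n => ?_
  have hpi : Measure.pi (fun _ : Fin n => ENNReal.ofReal l • ν) =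
      (ENNReal.ofReal l ^ n) • Measure.pi (fun _ : Fin n => ν) := by
    refine Measure.pi_eq fun s hs => ?_
    simp [Measure.pi_pi, Finset.prod_mul_distrib]
  rw [hpi, lintegral_smul_measure, ENNReal.ofReal_div_of_pos (by positivity),
    ENNReal.ofReal_mul (Real.exp_pos _).le,
    ENNReal.ofReal_pow hl, ENNReal.ofReal_natCast, div_eq_mul_inv, smul_eq_mul]
  ring

end poisson2
open scoped ENNReal

/-- the matching functional with values in `ℝ≥0∞` -/
noncomputable def LF (d : ℕ) : ∀ n k : ℕ, (Fin n → EuclideanSpace ℝ (Fin d)) →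
    (Fin k → EuclideanSpace ℝ (Fin d)) → ℝ≥0∞ := fun _ _ x y => ENNReal.ofReal (LMBM x y)

lemma measurable_LMBM (d n k : ℕ) : Measurable (fun p : (Fin n → EuclideanSpace ℝ (Fin d)) ×
    (Fin k → EuclideanSpace ℝ (Fin d)) => LMBM p.1 p.2) := by
  have : (fun p : (Fin n → EuclideanSpace ℝ (Fin d)) ×
    (Fin k → EuclideanSpace ℝ (Fin d)) => LMBM p.1 p.2) = fun p =>
    ⨅ q : (Fin (min (Finset.univ : Finset (Fin n)).card (Finset.univ : Finset (Fin k)).card) ↪ Fin n) ×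
      (Fin (min (Finset.univ : Finset (Fin n)).card (Finset.univ : Finset (Fin k)).card) ↪ Fin k),
      ∑ i, dist (p.1 (q.1 i)) (p.2 (q.2 i)) := by
    funext p
    unfold LMBM LMBMon iInf
    congr 1
    ext s
    simp only [Finset.mem_univ, implies_true, true_and, Set.mem_range, Prod.exists]
    constructor
    · rintro ⟨σ, τ, h⟩; exact ⟨σ, τ, h.symm⟩
    · rintro ⟨σ, τ, h⟩; exact ⟨σ, τ, h.symm⟩
  rw [this]
  refine Measurable.iInf fun q => Finset.measurable_sum _ fun i _ => ?_
  exact ((measurable_pi_apply _).comp measurable_fst).dist ((measurable_pi_apply _).comp measurable_snd)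

lemma MF_LF (d : ℕ) : MF (LF d) := fun n k => (measurable_LMBM d n k).ennreal_ofReal

lemma LMBM_le {d n k : ℕ} (x : Fin n → EuclideanSpace ℝ (Fin d))
    (y : Fin k → EuclideanSpace ℝ (Fin d)) (hx : ∀ i, x i ∈ hcube d) (hy : ∀ i, y i ∈ hcube d) :
    LMBM x y ≤ √d * n := by
  obtain ⟨M, hM, hc, hs⟩ := LMBMon_exists x y Finset.univ Finset.univ
  rw [LMBM, ← hs]
  have hcn : M.card ≤ n := by rw [hc]; simp
  calc ∑ p ∈ M, dist (x p.1) (y p.2) ≤ ∑ p ∈ M, √d * 1 := by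
        refine Finset.sum_le_sum fun p _ => dist_le_of_coord _ _ zero_le_one fun k => ?_
        have h1 := hx p.1 k
        have h2 := hy p.2 k
        rw [abs_le]; constructor <;> linarith [h1.1, h1.2, h2.1, h2.2]
    _ = √d * M.card := by simp [mul_comm]
    _ ≤ √d * n := by gcongr

lemma LMBM_scale {d n k : ℕ} (s : ℝ) (f : EuclideanSpace ℝ (Fin d) → EuclideanSpace ℝ (Fin d))
    (hf : ∀ a b, dist (f a) (f b) = s * dist a b) (x : Fin n → EuclideanSpace ℝ (Fin d))
    (y : Fin k → EuclideanSpace ℝ (Fin d)) :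
    LMBM (fun i => f (x i)) (fun i => f (y i)) ≤ s * LMBM x y := by
  obtain ⟨M, hM, hc, hs⟩ := LMBMon_exists x y Finset.univ Finset.univ
  have := LMBMon_le (fun i => f (x i)) (fun i => f (y i)) hM hc
  simp only [hf] at this
  rw [← Finset.mul_sum, hs] at this
  exact this

lemma hcube_eq (d : ℕ) : hcube d = (WithLp.ofLp : EuclideanSpace ℝ (Fin d) → (Fin d → ℝ)) ⁻¹'
    (Set.univ.pi fun _ => Set.Ico (0 : ℝ) 1) := by
  ext x; simp [hcube]

lemma measurableSet_hcube (d : ℕ) : MeasurableSet (hcube d) := by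
  rw [hcube_eq]
  exact (PiLp.volume_preserving_ofLp (Fin d)).measurable
    (MeasurableSet.univ_pi fun _ => measurableSet_Ico)

lemma unifCube_eq (d : ℕ) : unifCube d = volume.restrict (hcube d) := by
  unfold unifCube
  apply Measure.restrict_congr_set
  have : unitCube d = (WithLp.ofLp : EuclideanSpace ℝ (Fin d) → (Fin d → ℝ)) ⁻¹'
    (Set.Icc (fun _ => (0 : ℝ)) (fun _ => 1)) := by
    ext x; simp [unitCube, Pi.le_def, forall_and]
  rw [this, hcube_eq]
  exact (PiLp.volume_preserving_ofLp (Fin d)).quasiMeasurePreserving.preimage_ae_eq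
    Measure.univ_pi_Ico_ae_eq_Icc.symm

lemma vol_box {d : ℕ} (a b : Fin d → ℝ) :
    volume ((WithLp.ofLp : EuclideanSpace ℝ (Fin d) → (Fin d → ℝ)) ⁻¹'
      (Set.univ.pi fun i => Set.Ico (a i) (b i))) = ∏ i, ENNReal.ofReal (b i - a i) := by
  rw [(PiLp.volume_preserving_ofLp (Fin d)).measure_preimage
    (MeasurableSet.univ_pi fun _ => measurableSet_Ico).nullMeasurableSet, Real.volume_pi_Ico]

instance isProb_unifCube (d : ℕ) : IsProbabilityMeasure (unifCube d) := by
  refine ⟨?_⟩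
  rw [unifCube_eq, Measure.restrict_apply_univ, hcube_eq, vol_box]
  simp

lemma ae_hcube (d : ℕ) (c : ℝ≥0∞) : ∀ᵐ x ∂(c • unifCube d), x ∈ hcube d := by
  rw [unifCube_eq]
  exact Measure.ae_smul_measure (ae_restrict_mem (measurableSet_hcube d)) c

lemma measurable_lab (d m j : ℕ) : Measurable (lab (d := d) m j) := by
  refine measurable_pi_lambda _ fun k => ?_
  have h1 : Measurable (fun x : EuclideanSpace ℝ (Fin d) => (m : ℝ) * x k) := by fun_prop
  exact (measurable_from_top (f := fun n : ℕ => n / 2 ^ j)).comp (Nat.measurable_floor.comp h1)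

lemma measurableSet_blk {d : ℕ} (m j : ℕ) (b : Fin d → ℕ) : MeasurableSet (blk m j b) :=
  (measurableSet_hcube d).inter (measurable_lab d m j (measurableSet_singleton b))

lemma vol_blk {d m : ℕ} (hm : 1 ≤ m) (j : ℕ) (b : Fin d → ℕ) :
    volume (blk m j b) ≤ ENNReal.ofReal ((2 ^ j / m) ^ d) := by
  have hsub : blk m j b ⊆ (WithLp.ofLp : EuclideanSpace ℝ (Fin d) → (Fin d → ℝ)) ⁻¹'
      (Set.univ.pi fun i => Set.Ico ((b i * 2 ^ j : ℝ) / m) (((b i + 1) * 2 ^ j : ℝ) / m)) := by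
    intro x hx
    simp only [Set.mem_preimage, Set.mem_univ_pi]
    intro k
    exact coord_bounds hm hx k
  refine (measure_mono hsub).trans (le_of_eq ?_)
  rw [vol_box, ENNReal.ofReal_pow (by positivity)]
  rw [Finset.prod_congr rfl (g := fun _ => ENNReal.ofReal (2 ^ j / m))]
  · simp
  · intro i _
    congr 1; ring

lemma restrict_blk {d m : ℕ} (j : ℕ) (b : Fin d → ℕ) (c : ℝ≥0∞) :
    (c • unifCube d).restrict (blk m j b) = c • volume.restrict (blk m j b) := by
  rw [Measure.restrict_smul, unifCube_eq, Measure.restrict_restrict (measurableSet_blk m j b),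
    Set.inter_eq_left.2]
  exact fun x hx => hx.1

/-- affine map of the unit cube to a cell -/
noncomputable def aff {d : ℕ} (m : ℕ) (c : Fin d → ℕ) (x : EuclideanSpace ℝ (Fin d)) :
    EuclideanSpace ℝ (Fin d) := (m : ℝ)⁻¹ • (x + WithLp.toLp 2 (fun k => (c k : ℝ)))

lemma measurable_aff {d : ℕ} (m : ℕ) (c : Fin d → ℕ) : Measurable (aff m c) := by
  unfold aff; fun_prop

lemma dist_aff {d : ℕ} (m : ℕ) (c : Fin d → ℕ) (a b : EuclideanSpace ℝ (Fin d)) :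
    dist (aff m c a) (aff m c b) = (m : ℝ)⁻¹ * dist a b := by
  unfold aff
  rw [dist_smul₀, dist_add_right, Real.norm_of_nonneg (by positivity)]

lemma map_aff {d m : ℕ} (hm : 1 ≤ m) (c : Fin d → ℕ) :
    (volume : Measure (EuclideanSpace ℝ (Fin d))).map (aff m c) =
      ENNReal.ofReal ((m : ℝ) ^ d) • volume := by
  have h : aff m c = (fun x => (m : ℝ)⁻¹ • x) ∘
    (fun x => x + WithLp.toLp 2 (fun k => (c k : ℝ))) := rfl
  have hm' : (m : ℝ) ≠ 0 := by positivity
  rw [h, ← Measure.map_map (by fun_prop) (by fun_prop), map_add_right_eq_self,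
    Measure.map_addHaar_smul _ (inv_ne_zero hm')]
  simp

lemma preimage_aff {d m : ℕ} (hm : 1 ≤ m) {c : Fin d → ℕ} (hc : c ∈ labs d m 0) :
    aff m c ⁻¹' (blk m 0 c) = hcube d := by
  have hm' : (0 : ℝ) < m := by exact_mod_cast hm
  have hcm : ∀ k, (c k : ℝ) + 1 ≤ m := by
    intro k
    rw [labs, Fintype.mem_piFinset] at hc
    have := hc k
    rw [Finset.mem_range, pow_zero, Nat.div_one] at this
    have : c k + 1 ≤ m := by omega
    exact_mod_cast this
  have hk : ∀ (x : EuclideanSpace ℝ (Fin d)) k, aff m c x k = (m : ℝ)⁻¹ * (x k + c k) := by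
    intro x k; simp [aff, mul_add]
  have hmk : ∀ (x : EuclideanSpace ℝ (Fin d)) k, (m : ℝ) * aff m c x k = x k + c k := by
    intro x k; rw [hk, mul_inv_cancel_left₀ hm'.ne']
  ext x
  constructor
  · rintro ⟨h1, h2⟩ k
    have h3 := congrFun h2 k
    have h4 : 0 ≤ (m : ℝ) * aff m c x k := mul_nonneg hm'.le (h1 k).1
    simp only [lab, pow_zero, Nat.div_one] at h3
    rw [Nat.floor_eq_iff h4, hmk] at h3
    constructor <;> linarith [h3.1, h3.2]
  · intro hx
    refine ⟨fun k => ?_, ?_⟩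
    · have := hx k
      have hc0 : (0 : ℝ) ≤ c k := Nat.cast_nonneg _
      have := hcm k
      have h5 := hmk x k
      have h6 := (hx k).1
      have h7 := (hx k).2
      constructor
      · rw [hk]; positivity
      · by_contra hcon
        push Not at hcon
        nlinarith
    · funext k
      simp only [lab, pow_zero, Nat.div_one]
      rw [hmk, Nat.floor_eq_iff (add_nonneg (hx k).1 (Nat.cast_nonneg _))]
      constructor <;> linarith [(hx k).1, (hx k).2]

lemma restrict_cell {d m : ℕ} (hm : 1 ≤ m) {c : Fin d → ℕ} (hc : c ∈ labs d m 0) (N : ℝ)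
    (hN : 0 ≤ N) : (ENNReal.ofReal N • unifCube d).restrict (blk m 0 c) =
      (ENNReal.ofReal (N / (m : ℝ) ^ d) • unifCube d).map (aff m c) := by
  have hm' : (0 : ℝ) < m := by exact_mod_cast hm
  rw [restrict_blk, Measure.map_smul, unifCube_eq, ← preimage_aff hm hc,
    ← Measure.restrict_map (measurable_aff m c) (measurableSet_blk m 0 c), map_aff hm,
    Measure.restrict_smul, smul_smul, ← ENNReal.ofReal_mul (by positivity),
    div_mul_cancel₀ _ (by positivity)]

lemma PP_LF_lt_top (d : ℕ) (l : ℝ) :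
    PP (ENNReal.ofReal l • unifCube d) (LF d) < ⊤ := by
  have : IsFiniteMeasure (ENNReal.ofReal l • unifCube d) :=
    Measure.smul_finite _ ENNReal.ofReal_ne_top
  have h := PP_mono (ae_hcube d (ENNReal.ofReal l)) (F := LF d)
    (G := fun n k _ _ => ENNReal.ofReal (0 * (k : ℝ) ^ 2 + 0 * k + √d * n))
    (fun n k x y hx hy => ENNReal.ofReal_le_ofReal (by
      have := LMBM_le x y hx hy; linarith))
  refine h.trans_lt ?_
  unfold PP
  have e : ∀ n : ℕ, PE (ENNReal.ofReal l • unifCube d)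
      (fun k _ => ENNReal.ofReal (0 * (k : ℝ) ^ 2 + 0 * k + √d * n)) =
      ENNReal.ofReal (0 * (n : ℝ) ^ 2 + √d * n + 0) := by
    intro n
    rw [PE_quad _ _ _ _ (fun k => by positivity)]
    congr 1; ring
  simp_rw [e]
  rw [PE_quad _ _ _ _ (fun k => by positivity)]
  exact ENNReal.ofReal_lt_top

lemma MP_eq (d : ℕ) (l : ℝ) (hl : 0 ≤ l) :
    MP d l = (PP (ENNReal.ofReal l • unifCube d) (LF d)).toReal := by
  have hfin : IsFiniteMeasure (ENNReal.ofReal l • unifCube d) :=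
    Measure.smul_finite _ ENNReal.ofReal_ne_top
  set w : ℕ → ℝ := fun n => Real.exp (-l) * l ^ n / n.factorial with hw
  have hw0 : ∀ n, 0 ≤ w n := fun n => by positivity
  set J : ℕ → ℕ → ℝ≥0∞ := fun n k => ∫⁻ p, LF d n k p.1 p.2
    ∂((Measure.pi fun _ : Fin n => unifCube d).prod (Measure.pi fun _ : Fin k => unifCube d)) with hJ
  have h1 : PP (ENNReal.ofReal l • unifCube d) (LF d) =
      ∑' n, ∑' k, ENNReal.ofReal (w n) * (ENNReal.ofReal (w k) * J n k) := by
    unfold PP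
    rw [PE_smul_prob _ _ hl]
    refine tsum_congr fun n => ?_
    rw [ENNReal.tsum_mul_left]
    congr 1
    simp_rw [PE_smul_prob (unifCube d) l hl]
    rw [lintegral_tsum]
    · refine tsum_congr fun k => ?_
      rw [lintegral_const_mul _ (MF_LF d n k).lintegral_prod_right', hJ]
      simp only
      rw [lintegral_prod _ (MF_LF d n k).aemeasurable]
    · intro k
      exact ((MF_LF d n k).lintegral_prod_right'.const_mul _).aemeasurable
  have hlt := PP_LF_lt_top d l
  rw [h1] at hlt ⊢
  have hn : ∀ n, ∑' k, ENNReal.ofReal (w n) * (ENNReal.ofReal (w k) * J n k) ≠ ⊤ :=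
    fun n => ENNReal.ne_top_of_tsum_ne_top hlt.ne n
  rw [ENNReal.tsum_toReal_eq hn]
  unfold MP
  refine tsum_congr fun n => ?_
  rw [ENNReal.tsum_toReal_eq (fun k => ENNReal.ne_top_of_tsum_ne_top (hn n) k)]
  refine tsum_congr fun k => ?_
  rw [ENNReal.toReal_mul, ENNReal.toReal_mul, ENNReal.toReal_ofReal (hw0 n),
    ENNReal.toReal_ofReal (hw0 k), integral_eq_lintegral_of_nonneg_ae
      (f := fun p : (Fin n → EuclideanSpace ℝ (Fin d)) × (Fin k → EuclideanSpace ℝ (Fin d)) =>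
        LMBM p.1 p.2) (Filter.Eventually.of_forall fun p => LMBMon_nonneg _ _ _ _)
      (measurable_LMBM d n k).aestronglyMeasurable]
  rfl
open scoped ENNReal

lemma card_labs (d m j : ℕ) : (labs d m j).card = ((m - 1) / 2 ^ j + 1) ^ d := by
  simp [labs]

lemma real_bound (d : ℕ) (N : ℝ) (hN : 0 ≤ N) (m K k : ℕ) (hk : k ≤ K) (h0 : 2 ^ K ≤ m)
    (h1 : m ≤ 2 ^ (K + 1)) (hm : 1 ≤ m) :
    √d * 2 ^ (K - k) / m * ((((m - 1) / 2 ^ (K - k) + 1 : ℕ) : ℝ) ^ d *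
      √(2 * (N * (2 ^ (K - k) / m) ^ d))) ≤
    2 ^ d * Real.sqrt (2 * d * N) * (2 : ℝ) ^ ((k : ℝ) * ((d : ℝ) / 2 - 1)) := by
  have hm' : (0 : ℝ) < m := by exact_mod_cast hm
  set j := K - k with hj
  have hKj : K = k + j := by omega
  have hu : (2 : ℝ) ^ j / m ≤ (2 ^ k)⁻¹ := by
    rw [div_le_iff₀ hm', ← div_eq_inv_mul, le_div_iff₀ (by positivity), mul_comm, ← pow_add, ← hKj]
    exact_mod_cast h0
  have hc : (((m - 1) / 2 ^ j + 1 : ℕ) : ℝ) ≤ 2 * 2 ^ k := by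
    have : (m - 1) / 2 ^ j < 2 ^ (k + 1) := by
      rw [Nat.div_lt_iff_lt_mul (by positivity), ← pow_add]
      have : k + 1 + j = K + 1 := by omega
      rw [this]; omega
    have : (m - 1) / 2 ^ j + 1 ≤ 2 * 2 ^ k := by rw [pow_succ] at this; omega
    exact_mod_cast this
  calc √d * 2 ^ j / m * ((((m - 1) / 2 ^ j + 1 : ℕ) : ℝ) ^ d * √(2 * (N * (2 ^ j / m) ^ d)))
      = √d * (2 ^ j / m) * ((((m - 1) / 2 ^ j + 1 : ℕ) : ℝ) ^ d * √(2 * (N * (2 ^ j / m) ^ d))) := by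
        ring
    _ ≤ √d * (2 ^ k)⁻¹ * ((2 * 2 ^ k) ^ d * √(2 * (N * ((2 ^ k)⁻¹) ^ d))) := by gcongr
    _ = 2 ^ d * √(2 * d * N) * ((2 ^ k) ^ d * (2 ^ k)⁻¹ * √(((2 ^ k)⁻¹) ^ d)) := by
        have e1 : 2 * (N * ((2 ^ k : ℝ)⁻¹) ^ d) = (2 * N) * ((2 ^ k : ℝ)⁻¹) ^ d := by ring
        have e2 : 2 * (d : ℝ) * N = d * (2 * N) := by ring
        rw [e1, e2, Real.sqrt_mul (by positivity), Real.sqrt_mul (Nat.cast_nonneg d), mul_pow]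
        ring
    _ = _ := by
        congr 1
        have e1 : ((2 : ℝ) ^ k) = (2 : ℝ) ^ (k : ℝ) := (Real.rpow_natCast _ _).symm
        rw [Real.sqrt_eq_rpow, e1, ← Real.rpow_neg two_pos.le, ← Real.rpow_natCast,
          ← Real.rpow_natCast, ← Real.rpow_mul two_pos.le, ← Real.rpow_mul two_pos.le,
          ← Real.rpow_mul two_pos.le, ← Real.rpow_add two_pos, ← Real.rpow_add two_pos]
        congr 1
        ring

lemma cell_bound {d m : ℕ} (hm : 1 ≤ m) {c : Fin d → ℕ} (hc : c ∈ labs d m 0) (N : ℝ)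
    (hN : 0 ≤ N) : PP ((ENNReal.ofReal N • unifCube d).restrict (blk m 0 c)) (LF d) ≤
      ENNReal.ofReal ((m : ℝ)⁻¹ * MP d (N / (m : ℝ) ^ d)) := by
  have hfin : IsFiniteMeasure (ENNReal.ofReal (N / (m : ℝ) ^ d) • unifCube d) :=
    Measure.smul_finite _ ENNReal.ofReal_ne_top
  rw [restrict_cell hm hc N hN, PP_map (measurable_aff m c) (MF_LF d)]
  have h := PP_mono (μ := ENNReal.ofReal (N / (m : ℝ) ^ d) • unifCube d) (C := Set.univ) (by simp)
    (F := fun n k x y => LF d n k (fun i => aff m c (x i)) (fun i => aff m c (y i)))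
    (G := fun n k x y => ENNReal.ofReal (m : ℝ)⁻¹ * LF d n k x y) (by
      intro n k x y _ _
      unfold LF
      rw [← ENNReal.ofReal_mul (by positivity)]
      exact ENNReal.ofReal_le_ofReal (LMBM_scale _ _ (dist_aff m c) x y))
  refine h.trans (le_of_eq ?_)
  rw [PP_const_mul (MF_LF d), MP_eq d _ (by positivity), ENNReal.ofReal_mul (by positivity),
    ENNReal.ofReal_toReal (PP_LF_lt_top d _).ne]

lemma blk_bound {d m : ℕ} (hm : 1 ≤ m) (j : ℕ) (b : Fin d → ℕ) (N : ℝ) (hN : 0 < N) :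
    PP ((ENNReal.ofReal N • unifCube d).restrict (blk m j b)) AD ≤
      ENNReal.ofReal √(2 * (N * (2 ^ j / m) ^ d)) := by
  have hm' : (0 : ℝ) < m := by exact_mod_cast hm
  have hfin : IsFiniteMeasure (ENNReal.ofReal N • unifCube d) :=
    Measure.smul_finite _ ENNReal.ofReal_ne_top
  apply PP_AD _ _ (by positivity)
  rw [restrict_blk]
  refine ENNReal.toReal_le_of_le_ofReal (by positivity) ?_
  rw [Measure.smul_apply, Measure.restrict_apply_univ, smul_eq_mul, ENNReal.ofReal_mul hN.le]
  gcongr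
  exact vol_blk hm j b

lemma pp_bound {d m K : ℕ} (hm : 1 ≤ m) (hK : m ≤ 2 ^ (K + 1))
    (μ : Measure (EuclideanSpace ℝ (Fin d))) [IsFiniteMeasure μ] (hμ : ∀ᵐ x ∂μ, x ∈ hcube d) :
    PP μ (LF d) ≤ ∑ c ∈ labs d m 0, PP (μ.restrict (blk m 0 c)) (LF d) +
      ∑ j ∈ Finset.range (K + 1), ENNReal.ofReal (√d * 2 ^ j / m) *
        ∑ b ∈ labs d m j, PP (μ.restrict (blk m j b)) AD := by
  have hA : ∀ c, MF (RF (blk m 0 c) (LF d)) := fun c => (MF_LF d).rf (measurableSet_blk m 0 c)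
  have hB : ∀ j b, MF (RF (blk (d := d) m j b) AD) := fun j b => MF_AD.rf (measurableSet_blk m j b)
  have hB2 : ∀ j, MF (fun n k x y => ∑ b ∈ labs d m j, RF (blk (d := d) m j b) AD n k x y) :=
    fun j => MF.sum _ (hB j)
  have hB3 : ∀ j : ℕ, MF (fun n k x y => ENNReal.ofReal (√d * 2 ^ j / m) *
      ∑ b ∈ labs d m j, RF (blk (d := d) m j b) AD n k x y) := fun j => (hB2 j).const_mul _
  have h := PP_mono hμ (F := LF d) (G := fun n k x y =>
    (∑ c ∈ labs d m 0, RF (blk m 0 c) (LF d) n k x y) + ∑ j ∈ Finset.range (K + 1),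
      ENNReal.ofReal (√d * 2 ^ j / m) *
        ∑ b ∈ labs d m j, RF (blk (d := d) m j b) AD n k x y) (by
      intro n k x y hx hy
      have h1 := det_main hm hK x y hx hy
      have h2 : LMBM x y ≤ ∑ b ∈ labs d m 0, LMBM (rst (idx (blk m 0 b) x) x)
            (rst (idx (blk m 0 b) y) y) +
          ∑ j ∈ Finset.range (K + 1), √d * 2 ^ j / m * ∑ b ∈ labs d m j,
            |((idx (blk m j b) x).card : ℝ) - (idx (blk m j b) y).card| := by
        refine h1.trans (add_le_add (Finset.sum_le_sum fun b _ => ?_) le_rfl)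
        exact LMBMon_le_comp x y _ _
      refine (ENNReal.ofReal_le_ofReal h2).trans ?_
      refine ENNReal.ofReal_add_le.trans (add_le_add ?_ ?_)
      · have hnn : ∀ b ∈ labs d m 0, 0 ≤ LMBM (rst (idx (blk m 0 b) x) x)
            (rst (idx (blk m 0 b) y) y) := fun _ _ => LMBMon_nonneg _ _ _ _
        rw [ENNReal.ofReal_sum_of_nonneg hnn]
        exact le_rfl
      · rw [ENNReal.ofReal_sum_of_nonneg (fun _ _ => mul_nonneg (by positivity)
          (Finset.sum_nonneg fun _ _ => abs_nonneg _))]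
        refine Finset.sum_le_sum fun j _ => ?_
        rw [ENNReal.ofReal_mul (by positivity), ENNReal.ofReal_sum_of_nonneg
          (fun _ _ => abs_nonneg _)]
        exact le_rfl)
  refine h.trans (le_of_eq ?_)
  rw [PP_add (MF.sum _ hA), PP_sum _ hA, PP_sum _ hB3]
  congr 1
  · exact Finset.sum_congr rfl fun c _ => PP_thin μ (measurableSet_blk m 0 c) (MF_LF d)
  · refine Finset.sum_congr rfl fun j _ => ?_
    rw [PP_const_mul (hB2 j), PP_sum _ (hB j)]
    congr 1
    exact Finset.sum_congr rfl fun b _ => PP_thin μ (measurableSet_blk m j b) MF_AD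

/-- Subadditivity in the mean for the Poissonized minimum bipartite matching functional,
for a subdivision into `m^d` congruent subcubes, where `m = 2^K + r` with `0 ≤ r < 2^K`:
`M(N) ≤ m^{d−1} M(N/m^d) + 2^d √(2dN) ∑_{k=0}^{K} 2^{k(d/2−1)}`. -/
theorem MP_subadditive_general
    (d : ℕ) (hd : 1 ≤ d) (N : ℝ) (hN : 0 < N)
    (m K r : ℕ) (hm : 2 ≤ m) (hmKr : m = 2 ^ K + r) (hr : r < 2 ^ K) :
    MP d N ≤
      (m : ℝ) ^ (d - 1) * MP d (N / (m : ℝ) ^ d) +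
        2 ^ d * Real.sqrt (2 * d * N) *
          ∑ k ∈ Finset.range (K + 1), (2 : ℝ) ^ ((k : ℝ) * ((d : ℝ) / 2 - 1)) := by
  have hm1 : 1 ≤ m := by omega
  have hm' : (0 : ℝ) < m := by exact_mod_cast hm1
  have hK1 : m ≤ 2 ^ (K + 1) := by rw [pow_succ]; omega
  have hK0 : 2 ^ K ≤ m := by omega
  have hfin : IsFiniteMeasure (ENNReal.ofReal N • unifCube d) :=
    Measure.smul_finite _ ENNReal.ofReal_ne_top
  have hNm : 0 ≤ N / (m : ℝ) ^ d := by positivity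
  set μ := ENNReal.ofReal N • unifCube d with hμ
  have hcell : ∀ c ∈ labs d m 0, PP (μ.restrict (blk m 0 c)) (LF d) ≤
      ENNReal.ofReal ((m : ℝ)⁻¹ * MP d (N / (m : ℝ) ^ d)) := fun c hc =>
    cell_bound hm1 hc N hN.le
  have hblk : ∀ j, ∀ b : Fin d → ℕ, PP (μ.restrict (blk m j b)) AD ≤
      ENNReal.ofReal √(2 * (N * (2 ^ j / m) ^ d)) := fun j b => blk_bound hm1 j b N hN
  have hMP0 : 0 ≤ MP d (N / (m : ℝ) ^ d) := by rw [MP_eq d _ hNm]; exact ENNReal.toReal_nonneg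
  have hmain : PP μ (LF d) ≤ ENNReal.ofReal ((m : ℝ) ^ d * ((m : ℝ)⁻¹ * MP d (N / (m : ℝ) ^ d)) +
      ∑ j ∈ Finset.range (K + 1), √d * 2 ^ j / m *
        ((((m - 1) / 2 ^ j + 1 : ℕ) : ℝ) ^ d * √(2 * (N * (2 ^ j / m) ^ d)))) := by
    refine (pp_bound hm1 hK1 μ (by rw [hμ]; exact ae_hcube d _)).trans ?_
    rw [ENNReal.ofReal_add (by positivity) (Finset.sum_nonneg fun _ _ => by positivity),
      ENNReal.ofReal_sum_of_nonneg (fun _ _ => by positivity)]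
    refine add_le_add ?_ (Finset.sum_le_sum fun j _ => ?_)
    · refine (Finset.sum_le_sum hcell).trans (le_of_eq ?_)
      rw [Finset.sum_const, card_labs, pow_zero, Nat.div_one, Nat.sub_add_cancel hm1, nsmul_eq_mul,
        ENNReal.ofReal_mul (p := (m : ℝ) ^ d) (by positivity), ENNReal.ofReal_pow (by positivity),
        ENNReal.ofReal_natCast, Nat.cast_pow]
    · rw [ENNReal.ofReal_mul (p := √d * 2 ^ j / m) (by positivity)]
      gcongr
      refine (Finset.sum_le_sum fun b _ => hblk j b).trans (le_of_eq ?_)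
      rw [Finset.sum_const, card_labs, nsmul_eq_mul,
        ENNReal.ofReal_mul (by positivity), ENNReal.ofReal_pow (by positivity),
        ENNReal.ofReal_natCast, Nat.cast_pow]
  rw [MP_eq d N hN.le]
  refine (ENNReal.toReal_le_of_le_ofReal ?_ hmain).trans ?_
  · exact add_nonneg (by positivity) (Finset.sum_nonneg fun _ _ => by positivity)
  · refine add_le_add (le_of_eq ?_) ?_
    · obtain ⟨e, rfl⟩ : ∃ e, d = e + 1 := ⟨d - 1, by omega⟩
      rw [Nat.add_sub_cancel, ← mul_assoc]
      congr 1
      rw [pow_succ, mul_assoc, mul_inv_cancel₀ hm'.ne', mul_one]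
    · rw [Finset.mul_sum, ← Finset.sum_range_reflect]
      refine Finset.sum_le_sum fun k hk => ?_
      have hk : k ≤ K := Nat.lt_succ_iff.1 (Finset.mem_range.1 hk)
      rw [Nat.add_sub_cancel]
      exact real_bound d N hN.le m K k hk hK0 hK1 hm1
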